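/- arXiv:2310.17727 — 2 statements merged into one kernel-verified Lean document; each statement's English description precedes it below -/
import Mathlib

section
/- Positivity of a degree-three chain polynomial (Remark following Corollary 4.8): Let M be a real 4 × n matrix all of whose 4 × 4 minors (on increasing column sets) are positive, and let 1 ≤ i < j < ℓ < q < r < s < t < a < b < c < d < n be twelve indices with n the last column of M. Then ⟨i j ℓ q⟩⟨r s t a⟩⟨b c d n⟩ − ⟨i j ℓ q⟩⟨r s t b⟩⟨a c d n⟩ − ⟨i j ℓ r⟩⟨q s t a⟩⟨b c d n⟩ + ⟨i j ℓ r⟩⟨q s t b⟩⟨a c d n⟩ > 0, where ⟨p q r s⟩ denotes the determinant of the 4 × 4 matrix whose columns are columns p, q, r, s of M in that listed order. (This quantity is the chain polynomial ⟨i j ℓ | q r | s t | a b | c d n⟩.) -/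
open Matrix

/-- A real `4 × n` matrix is totally positive if all of its `4 × 4` minors,
taken with columns in increasing order, are positive. -/
def TotPos {n : ℕ} (M : Matrix (Fin 4) (Fin n) ℝ) : Prop :=
  ∀ f : Fin 4 → Fin n, StrictMono f → 0 < (M.submatrix id f).det

/-- `⟨p q r s⟩`: the determinant of the `4 × 4` matrix whose columns are the
columns `p, q, r, s` of `M`, in that listed order. -/
noncomputable def br {n : ℕ} (M : Matrix (Fin 4) (Fin n) ℝ) (p q r s : Fin n) : ℝ :=
  (M.submatrix id ![p, q, r, s]).det

lemma br_eq {n : ℕ} (M : Matrix (Fin 4) (Fin n) ℝ) (p q r s : Fin n) : br M p q r s =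
    (M 0 p * M 1 q - M 1 p * M 0 q) * (M 2 r * M 3 s - M 3 r * M 2 s)
    - (M 0 p * M 2 q - M 2 p * M 0 q) * (M 1 r * M 3 s - M 3 r * M 1 s)
    + (M 0 p * M 3 q - M 3 p * M 0 q) * (M 1 r * M 2 s - M 2 r * M 1 s)
    + (M 1 p * M 2 q - M 2 p * M 1 q) * (M 0 r * M 3 s - M 3 r * M 0 s)
    - (M 1 p * M 3 q - M 3 p * M 1 q) * (M 0 r * M 2 s - M 2 r * M 0 s)
    + (M 2 p * M 3 q - M 3 p * M 2 q) * (M 0 r * M 1 s - M 1 r * M 0 s) := by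
  unfold br
  rw [Matrix.det_succ_row_zero]
  simp [Fin.sum_univ_succ, Matrix.det_fin_three, Fin.succAbove]
  ring

lemma br_sw12 {n : ℕ} (M : Matrix (Fin 4) (Fin n) ℝ) (p q r s : Fin n) :
    br M p q r s = - br M q p r s := by simp only [br_eq]; ring
lemma br_sw23 {n : ℕ} (M : Matrix (Fin 4) (Fin n) ℝ) (p q r s : Fin n) :
    br M p q r s = - br M p r q s := by simp only [br_eq]; ring
lemma br_sw34 {n : ℕ} (M : Matrix (Fin 4) (Fin n) ℝ) (p q r s : Fin n) :
    br M p q r s = - br M p q s r := by simp only [br_eq]; ring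

lemma br_rotA {n : ℕ} (M : Matrix (Fin 4) (Fin n) ℝ) (x y u v : Fin n) :
    br M x y u v = br M u x y v := by rw [br_sw23, br_sw12]; ring
lemma br_rotB {n : ℕ} (M : Matrix (Fin 4) (Fin n) ℝ) (x y u v : Fin n) :
    br M x y u v = br M u v x y := by
  rw [br_rotA, br_sw34, br_sw23]; ring
/-- three-term Plücker relation -/
lemma plu {n : ℕ} (M : Matrix (Fin 4) (Fin n) ℝ) (x y a b c d : Fin n) :
    br M x y a b * br M x y c d - br M x y a c * br M x y b d
      + br M x y a d * br M x y b c = 0 := by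
  simp only [br_eq]
  ring

lemma plu14 {n : ℕ} (M : Matrix (Fin 4) (Fin n) ℝ) (x y a b c d : Fin n) :
    br M x a b y * br M x c d y - br M x a c y * br M x b d y
      + br M x a d y * br M x b c y = 0 := by
  have h := plu M x y a b c d
  have e : ∀ u v, br M x y u v = br M x u v y := fun u v => by
    rw [br_sw23, br_sw34]; ring
  simpa only [e] using h

lemma plu34 {n : ℕ} (M : Matrix (Fin 4) (Fin n) ℝ) (x y a b c d : Fin n) :
    br M a b x y * br M c d x y - br M a c x y * br M b d x y
      + br M a d x y * br M b c x y = 0 := by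
  have h := plu M x y a b c d
  simpa only [br_rotB M x y] using h

lemma br_pos {n : ℕ} {M : Matrix (Fin 4) (Fin n) ℝ} (hM : TotPos M) {p q r s : Fin n}
    (h1 : p < q) (h2 : q < r) (h3 : r < s) : 0 < br M p q r s := by
  apply hM
  rw [Fin.strictMono_iff_lt_succ]
  intro k
  fin_cases k <;> simpa

lemma keyF {n : ℕ} {M : Matrix (Fin 4) (Fin n) ℝ} (hM : TotPos M) {x j l q r s t : Fin n}
    (h0 : x < j) (h1 : j < l) (h2 : l < q) (h3 : q < r) (h4 : r < s) (h5 : s < t) :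
    0 < br M x j l r * br M x q s t - br M x j l q * br M x r s t := by
  have p1 := plu14 M x t j q r s
  have p2 := plu M x j l q r t
  have a1 : 0 < br M x j q t := br_pos hM (by order) (by order) (by order)
  have a2 : 0 < br M x j l q := br_pos hM (by order) (by order) (by order)
  have a3 : 0 < br M x q r t := br_pos hM (by order) (by order) (by order)
  have a4 : 0 < br M x j s t := br_pos hM (by order) (by order) (by order)
  have a5 : 0 < br M x j l t := br_pos hM (by order) (by order) (by order)
  have a6 : 0 < br M x j q r := br_pos hM (by order) (by order) (by order)
  have a7 : 0 < br M x q s t := br_pos hM (by order) (by order) (by order)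
  refine pos_of_mul_pos_right (a := br M x j q t) ?_ a1.le
  have : br M x j q t * (br M x j l r * br M x q s t - br M x j l q * br M x r s t)
      = br M x j l q * br M x q r t * br M x j s t
        + br M x j l t * br M x j q r * br M x q s t := by
    linear_combination (-br M x j l q) * p1 - br M x q s t * p2
  rw [this]; positivity

lemma keyL {n : ℕ} {M : Matrix (Fin 4) (Fin n) ℝ} (hM : TotPos M) {x j l q r s t : Fin n}
    (h1 : j < l) (h2 : l < q) (h3 : q < r) (h4 : r < s) (h5 : s < t) (h0 : t < x) :
    0 < br M j l r x * br M q s t x - br M j l q x * br M r s t x := by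
  have p1 := plu34 M t x j q r s
  have p2 := plu14 M j x l q r t
  have a1 : 0 < br M j q t x := br_pos hM (by order) (by order) (by order)
  have a2 : 0 < br M j l q x := br_pos hM (by order) (by order) (by order)
  have a3 : 0 < br M q r t x := br_pos hM (by order) (by order) (by order)
  have a4 : 0 < br M j s t x := br_pos hM (by order) (by order) (by order)
  have a5 : 0 < br M j l t x := br_pos hM (by order) (by order) (by order)
  have a6 : 0 < br M j q r x := br_pos hM (by order) (by order) (by order)
  have a7 : 0 < br M q s t x := br_pos hM (by order) (by order) (by order)
  refine pos_of_mul_pos_right (a := br M j q t x) ?_ a1.le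
  have : br M j q t x * (br M j l r x * br M q s t x - br M j l q x * br M r s t x)
      = br M j l q x * br M q r t x * br M j s t x
        + br M j l t x * br M j q r x * br M q s t x := by
    linear_combination (-br M j l q x) * p1 - br M q s t x * p2
  rw [this]; positivity

/-- **Positivity of the degree-three chain polynomial `⟨i j ℓ | q r | s t | a b | c d n⟩`**
(Remark following Corollary 4.8).  Here `nn` is the last column of `M` (the paper's `n`). -/
theorem cubic_chain_positive (n : ℕ) (M : Matrix (Fin 4) (Fin n) ℝ) (hM : TotPos M)
    (i j l q r s t a b c d nn : Fin n) (hnn : (nn : ℕ) + 1 = n)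
    (h1 : i < j) (h2 : j < l) (h3 : l < q) (h4 : q < r) (h5 : r < s) (h6 : s < t)
    (h7 : t < a) (h8 : a < b) (h9 : b < c) (h10 : c < d) (h11 : d < nn) :
    0 < br M i j l q * br M r s t a * br M b c d nn
        - br M i j l q * br M r s t b * br M a c d nn
        - br M i j l r * br M q s t a * br M b c d nn
        + br M i j l r * br M q s t b * br M a c d nn := by
  have α0 : 0 < br M i j l q := br_pos hM (by order) (by order) (by order)
  have γ0 : 0 < br M b c d nn := br_pos hM (by order) (by order) (by order)
  have k1 : 0 < br M i j l r * br M s t i q - br M i j l q * br M s t i r := by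
    rw [br_rotB M s t i q, br_rotB M s t i r]
    exact keyF hM h1 h2 h3 h4 h5 h6
  have k2 : 0 < br M a c d nn * br M s t b nn - br M b c d nn * br M s t a nn := by
    have := keyL hM h6 h7 h8 h9 h10 h11
    linarith
  have L : ∀ u v, u < s → t < v → 0 < br M s t u v := fun u v hu hv => by
    rw [br_rotA]; exact br_pos hM hu h6 hv
  have iq : 0 < br M s t i q := by
    rw [br_rotB]; exact br_pos hM (by order) (by order) (by order)
  have qr : 0 < br M s t q r := by
    rw [br_rotB]; exact br_pos hM (by order) (by order) (by order)
  have ab : 0 < br M s t a b := br_pos hM (by order) (by order) (by order)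
  have bn : 0 < br M s t b nn := br_pos hM (by order) (by order) (by order)
  have X : ∀ v, t < v → 0 < br M i j l r * br M s t q v - br M i j l q * br M s t r v := by
    intro v hv
    have p := plu M s t i q r v
    have e1 := L i v (by order) hv
    have e2 := L q v (by order) hv
    refine pos_of_mul_pos_right (a := br M s t i q) ?_ iq.le
    have : br M s t i q * (br M i j l r * br M s t q v - br M i j l q * br M s t r v)
      = br M i j l q * br M s t q r * br M s t i v
        + (br M i j l r * br M s t i q - br M i j l q * br M s t i r) * br M s t q v := by
      linear_combination (-br M i j l q) * p
    rw [this]; positivity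
  have Xb := X b (by order)
  have Xn := X nn (by order)
  have pq := plu M s t q a b nn
  have pr := plu M s t r a b nn
  rw [← br_rotA M s t r a, ← br_rotA M s t r b, ← br_rotA M s t q a, ← br_rotA M s t q b]
  refine pos_of_mul_pos_right (a := br M s t b nn) ?_ bn.le
  have h1 := mul_pos k2 Xb
  have h2 := mul_pos (mul_pos γ0 ab) Xn
  have h3 := add_pos h1 h2
  refine lt_of_lt_of_eq h3 ?_
  linear_combination br M b c d nn * (br M i j l r * pq - br M i j l q * pr)
end

section
/- The same-end exchange relation R3a as a Plücker identity (Lemma 6.24, relation R3a, stated with sorted-column sign conventions): For any seven vectors v_p, v_q, v_a, v_b, v_c, v_d, v_e ∈ ℝ⁴, writing ⟨w x y z⟩ := det(v_w, v_x, v_y, v_z), one has ⟨a b c e⟩·(⟨p q d b⟩⟨a c d e⟩ − ⟨p q d a⟩⟨b c d e⟩) = (⟨p q e c⟩⟨d a b e⟩ − ⟨p q e d⟩⟨c a b e⟩)·⟨a b c d⟩ + ⟨a b d e⟩·(⟨p q c b⟩⟨a c d e⟩ − ⟨p q c a⟩⟨b c d e⟩). (With (p,q) = (a_j,b_j), (a,b,c,d)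 = (a_i,b_i,c_i,d_i) and e = n, this is, up to the paper's chain-polynomial sign conventions, the exchange relation ⟨a_i b_i c_i n⟩·⟨a_j b_j d_i | a_i b_i | c_i d_i n⟩ = ⟨a_j b_j n | c_i d_i | a_i b_i n⟩·⟨a_i b_i c_i d_i⟩ + ⟨a_i b_i d_i n⟩·⟨a_j b_j c_i | b_i a_i | c_i d_i n⟩ for a same-end nonsticky child.) -/
open Matrix

/-- `det4 w₁ w₂ w₃ w₄`: the determinant of the `4 × 4` matrix whose columns are
`w₁, w₂, w₃, w₄` in that order; it is alternating in the four vectors. -/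
noncomputable def det4 (w₁ w₂ w₃ w₄ : Fin 4 → ℝ) : ℝ :=
  (Matrix.of fun i j => ![w₁, w₂, w₃, w₄] j i).det

theorem det4_expand (p q x y : Fin 4 → ℝ) : det4 p q x y =
    (p 0 * q 1 - p 1 * q 0) * (x 2 * y 3 - x 3 * y 2)
    - (p 0 * q 2 - p 2 * q 0) * (x 1 * y 3 - x 3 * y 1)
    + (p 0 * q 3 - p 3 * q 0) * (x 1 * y 2 - x 2 * y 1)
    + (p 1 * q 2 - p 2 * q 1) * (x 0 * y 3 - x 3 * y 0)
    - (p 1 * q 3 - p 3 * q 1) * (x 0 * y 2 - x 2 * y 0)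
    + (p 2 * q 3 - p 3 * q 2) * (x 0 * y 1 - x 1 * y 0) := by
  simp [det4, Matrix.det_succ_row_zero, Fin.sum_univ_succ, Fin.succAbove]
  ring

theorem det4_cramer (a b c d e : Fin 4 → ℝ) (i : Fin 4) :
    det4 a b c d * e i - det4 a b c e * d i + det4 a b d e * c i
      - det4 a c d e * b i + det4 b c d e * a i = 0 := by
  simp only [det4_expand]
  fin_cases i <;> simp only [Fin.zero_eta, Fin.mk_one, Fin.reduceFinMk] <;> ring

theorem det4_lin (p q x : Fin 4 → ℝ) : ∃ L : Fin 4 → ℝ, ∀ y,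
    det4 p q x y = L 0 * y 0 + L 1 * y 1 + L 2 * y 2 + L 3 * y 3 := by
  refine ⟨fun i => det4 p q x (Pi.single i 1), fun y => ?_⟩
  simp [det4_expand, Pi.single_apply]
  ring

theorem det4_rel (p q x a b c d e : Fin 4 → ℝ) :
    det4 a b c d * det4 p q x e - det4 a b c e * det4 p q x d
      + det4 a b d e * det4 p q x c
      - det4 a c d e * det4 p q x b + det4 b c d e * det4 p q x a = 0 := by
  obtain ⟨L, hL⟩ := det4_lin p q x
  have h := det4_cramer a b c d e
  rw [hL a, hL b, hL c, hL d, hL e]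
  linear_combination L 0 * h 0 + L 1 * h 1 + L 2 * h 2 + L 3 * h 3

theorem det4_swap (p q x y : Fin 4 → ℝ) : det4 p q x y = - det4 p q y x := by
  simp only [det4_expand]; ring

theorem det4_self (p q x : Fin 4 → ℝ) : det4 p q x x = 0 := by
  simp only [det4_expand]; ring

theorem det4_cyc (x a b e : Fin 4 → ℝ) : det4 x a b e = det4 a b x e := by
  simp only [det4_expand]; ring

/-- **The same-end exchange relation R3a as a Plücker identity** (Lemma 6.24, relation
R3a, with sorted-column sign conventions):
`⟨a b c e⟩·(⟨p q d b⟩⟨a c d e⟩ − ⟨p q d a⟩⟨b c d e⟩) =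
(⟨p q e c⟩⟨d a b e⟩ − ⟨p q e d⟩⟨c a b e⟩)·⟨a b c d⟩ +
⟨a b d e⟩·(⟨p q c b⟩⟨a c d e⟩ − ⟨p q c a⟩⟨b c d e⟩)`. -/
theorem same_end_exchange_relation (p q a b c d e : Fin 4 → ℝ) :
    det4 a b c e * (det4 p q d b * det4 a c d e - det4 p q d a * det4 b c d e) =
      (det4 p q e c * det4 d a b e - det4 p q e d * det4 c a b e) * det4 a b c d +
        det4 a b d e * (det4 p q c b * det4 a c d e - det4 p q c a * det4 b c d e) := by
  have hd := det4_rel p q d a b c d e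
  have hc := det4_rel p q c a b c d e
  rw [det4_self] at hd hc
  rw [det4_cyc d a b e, det4_cyc c a b e, det4_swap p q e c, det4_swap p q e d]
  rw [det4_swap p q d c] at hd
  linear_combination (-det4 a b c e) * hd + det4 a b d e * hc
end
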